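/- Let w > 0, k > 0 and M be reals with M ≥ k + 2w. Let H be the gadget graph with vertices u, u₁, u₂, u₃, u₄ and ũ, ũ₁, ũ₂, ũ₃, ũ₄, edges {u,u₁}, {u₁,u₂}, {u₂,u₃}, {u₂,u₄}, {u₃,u₄} together with {u,ũ}, {u₁,ũ₁}, {u₂,ũ₂}, {u₃,ũ₃}, {u₄,ũ₄}, and vertex weights w_u = w, w_{u₁} = w_{u₄} = M − w, w_{u₂} = w_{u₃} = k + w, and weight M + k + 1 on each of ũ, ũ₁, ũ₂, ũ₃, ũ₄. Then there exists an orientation Λ of H with weighted star value x(H,Λ) ≤ M + k. -/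

import Mathlib

open Finset

/-- An orientation of a simple graph `G`: `dir u v = true` means the edge `{u,v}`
is directed from `u` (tail) to `v` (head), i.e. the edge receives color `u`. -/
structure GraphOrientation {V : Type*} (G : SimpleGraph V) where
  dir : V → V → Bool
  adj_of_dir : ∀ u v, dir u v = true → G.Adj u v
  dir_iff : ∀ u v, G.Adj u v → (dir u v = true ↔ dir v u = false)

variable {V : Type*} [Fintype V]

/-- The indegree of `v` under an orientation. -/
def GraphOrientation.indeg {G : SimpleGraph V} (Λ : GraphOrientation G) (v : V) : ℕ :=
  (univ.filter fun u => Λ.dir u v = true).card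

/-- The outdegree of `v` under an orientation. -/
def GraphOrientation.outdeg {G : SimpleGraph V} (Λ : GraphOrientation G) (v : V) : ℕ :=
  (univ.filter fun u => Λ.dir v u = true).card

/-- The star value `x(G,Λ,v) = δ⁻(v) + (1 if δ⁺(v) > 0 else 0)`. -/
def GraphOrientation.starVal {G : SimpleGraph V} (Λ : GraphOrientation G) (v : V) : ℕ :=
  Λ.indeg v + (if 0 < Λ.outdeg v then 1 else 0)

/-- `x(G,Λ) = max over vertices of the star value`. -/
def GraphOrientation.starMax {G : SimpleGraph V} (Λ : GraphOrientation G) : ℕ :=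
  univ.sup fun v => Λ.starVal v

/-- The min-max star partitioning number `x*(G)` (no capacity constraints). -/
noncomputable def xStar (G : SimpleGraph V) : ℕ :=
  sInf {n | ∃ Λ : GraphOrientation G, Λ.starMax = n}

/-- The weighted indegree `k(G,Λ,v)`: the sum of the weights of the tails of the
edges directed toward `v`. -/
def GraphOrientation.wIndeg {G : SimpleGraph V} (Λ : GraphOrientation G)
    (w : V → ℝ) (v : V) : ℝ :=
  ∑ u ∈ univ.filter (fun u => Λ.dir u v = true), w u

/-- The weighted star value `x(G,Λ,v) = k(G,Λ,v) + (w_v if v has an outgoing edge)`. -/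
def GraphOrientation.wStarVal {G : SimpleGraph V} (Λ : GraphOrientation G)
    (w : V → ℝ) (v : V) : ℝ :=
  Λ.wIndeg w v + (if 0 < Λ.outdeg v then w v else 0)

/-- `k(G,Λ) = max over vertices of the weighted indegree`. -/
noncomputable def GraphOrientation.wIndegMax [Nonempty V] {G : SimpleGraph V}
    (Λ : GraphOrientation G) (w : V → ℝ) : ℝ :=
  univ.sup' univ_nonempty (Λ.wIndeg w)

/-- `x(G,Λ) = max over vertices of the weighted star value`. -/
noncomputable def GraphOrientation.wStarMax [Nonempty V] {G : SimpleGraph V}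
    (Λ : GraphOrientation G) (w : V → ℝ) : ℝ :=
  univ.sup' univ_nonempty (Λ.wStarVal w)

/-- The gadget edges among `u = 0, u₁ = 1, u₂ = 2, u₃ = 3, u₄ = 4`:
`{u,u₁}, {u₁,u₂}, {u₂,u₃}, {u₂,u₄}, {u₃,u₄}`. -/
def gadgetPair (i j : Fin 5) : Prop :=
  (i = 0 ∧ j = 1) ∨ (i = 1 ∧ j = 2) ∨ (i = 2 ∧ j = 3) ∨ (i = 2 ∧ j = 4) ∨ (i = 3 ∧ j = 4)

/-- The gadget graph `G_u` on the vertices `u, u₁, u₂, u₃, u₄` (encoded as `Sum.inl i`)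
and `ũ, ũ₁, ũ₂, ũ₃, ũ₄` (encoded as `Sum.inr i`), with the five gadget edges together
with the pendant edges `{u_i, ũ_i}`. -/
def gadgetGraph : SimpleGraph (Fin 5 ⊕ Fin 5) :=
  SimpleGraph.fromRel (fun a b =>
    match a, b with
    | .inl i, .inl j => gadgetPair i j
    | .inl i, .inr j => i = j
    | _, _ => False)

/-- The gadget weights: `w_u = w`, `w_{u₁} = w_{u₄} = M - w`, `w_{u₂} = w_{u₃} = k + w`
and `M + k + 1` on each vertex `ũ_i`. -/
noncomputable def gadgetWeight (w k M : ℝ) : Fin 5 ⊕ Fin 5 → ℝ :=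
  Sum.elim ![w, M - w, k + w, k + w, M - w] (fun _ => M + k + 1)

/-- The arcs of the orientation `u₁ → u`, `u₂ → u₁`, `u₂ → u₃ → u₄ → u₂`, `uᵢ → ũᵢ`. -/
def gadgetDir : Fin 5 ⊕ Fin 5 → Fin 5 ⊕ Fin 5 → Bool
  | .inl i, .inl j =>
    decide ((i, j) ∈ ([(1, 0), (2, 1), (2, 3), (3, 4), (4, 2)] : List (Fin 5 × Fin 5)))
  | .inl i, .inr j => decide (i = j)
  | .inr _, _ => false

/-- The orientation of the gadget graph with arcs `gadgetDir`. -/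
def gadgetOrientation : GraphOrientation gadgetGraph where
  dir := gadgetDir
  adj_of_dir := by
    rintro (i | i) (j | j) <;>
      simp only [gadgetGraph, gadgetDir, gadgetPair, SimpleGraph.fromRel_adj] <;>
      revert i j <;> decide
  dir_iff := by
    rintro (i | i) (j | j) <;>
      simp only [gadgetGraph, gadgetDir, gadgetPair, SimpleGraph.fromRel_adj] <;>
      revert i j <;> decide

lemma GraphOrientation.wStarVal_le {V : Type*} [Fintype V] {G : SimpleGraph V}
    (Λ : GraphOrientation G) (w : V → ℝ) (v : V) (hv : 0 ≤ w v) :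
    Λ.wStarVal w v ≤ Λ.wIndeg w v + w v := by
  unfold GraphOrientation.wStarVal
  split_ifs <;> linarith

/-- For `w, k > 0` and `M ≥ k + 2w`, the gadget graph admits an
orientation with weighted star value at most `M + k`. -/
theorem stmt13 (w k M : ℝ) (hw : 0 < w) (hk : 0 < k) (hM : k + 2 * w ≤ M) :
    ∃ Λ : GraphOrientation gadgetGraph,
      Λ.wStarMax (gadgetWeight w k M) ≤ M + k := by
  refine ⟨gadgetOrientation, Finset.sup'_le _ _ ?_⟩
  rintro (i | i) -
  · refine (gadgetOrientation.wStarVal_le _ _ ?_).trans ?_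
    · fin_cases i <;> simp [gadgetWeight] <;> linarith
    · fin_cases i <;>
        simp [GraphOrientation.wIndeg, gadgetOrientation, gadgetDir, gadgetWeight,
          Finset.sum_filter] <;>
        linarith
  · have hout : gadgetOrientation.outdeg (.inr i) = 0 := by
      simp [GraphOrientation.outdeg, gadgetOrientation, gadgetDir]
    fin_cases i <;>
      simp_all [GraphOrientation.wStarVal, GraphOrientation.wIndeg, gadgetOrientation,
        gadgetDir, gadgetWeight, Finset.sum_filter] <;>
      linarith
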